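/- arXiv:1304.0829 — 4 statements merged into one kernel-verified Lean document; each statement's English description precedes it below -/
import Mathlib

section
/- Let c, d, M, N be natural numbers with c ≥ 1, d ≥ 1, M ≥ 1 and N ≥ 1. There exists a (c, at-least-d)-biregular bipartite graph of size (M,N) if and only if M ≥ d, N ≥ c and M·c ≥ N·d. -/
/-- For naturals `c, d, M, N ≥ 1`, there exists a
`(c, at-least-d)`-biregular bipartite graph of size `(M,N)` (every `U`-vertex of
degree exactly `c`, every `V`-vertex of degree at least `d`) iff
`M ≥ d`, `N ≥ c` and `M·c ≥ N·d`. -/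
theorem biregular_exists_atLeast_iff (c d M N : ℕ) (hc : 1 ≤ c) (hd : 1 ≤ d)
    (hM : 1 ≤ M) (hN : 1 ≤ N) :
    (∃ E : Finset (Fin M × Fin N),
      (∀ u : Fin M, (E.filter (fun e => e.1 = u)).card = c) ∧
      (∀ v : Fin N, d ≤ (E.filter (fun e => e.2 = v)).card)) ↔
    (d ≤ M ∧ c ≤ N ∧ N * d ≤ M * c) := by
  constructor
  · rintro ⟨E, h1, h2⟩
    refine ⟨?_, ?_, ?_⟩
    · refine (h2 ⟨0, hN⟩).trans ?_
      have := Finset.card_le_card_of_injOn (s := E.filter (fun e => e.2 = ⟨0, hN⟩))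
        (t := (Finset.univ : Finset (Fin M))) Prod.fst (by simp [Set.MapsTo]) (by
          rintro ⟨a, b⟩ ha ⟨a', b'⟩ ha' h
          simp at ha ha' h
          simp [h, ha.2, ha'.2])
      simpa using this
    · rw [← h1 ⟨0, hM⟩]
      have := Finset.card_le_card_of_injOn (s := E.filter (fun e => e.1 = ⟨0, hM⟩))
        (t := (Finset.univ : Finset (Fin N))) Prod.snd (by simp [Set.MapsTo]) (by
          rintro ⟨a, b⟩ ha ⟨a', b'⟩ ha' h
          simp at ha ha' h
          simp [h, ha.2, ha'.2])
      simpa using this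
    · have e1 := Finset.card_eq_sum_card_fiberwise (f := Prod.fst) (s := E)
        (t := (Finset.univ : Finset (Fin M))) (by simp [Set.MapsTo])
      have e2 := Finset.card_eq_sum_card_fiberwise (f := Prod.snd) (s := E)
        (t := (Finset.univ : Finset (Fin N))) (by simp [Set.MapsTo])
      have e3 : ∑ v : Fin N, d ≤ ∑ v : Fin N, (E.filter (fun e => e.2 = v)).card :=
        Finset.sum_le_sum (fun v _ => h2 v)
      simp only [h1] at e1
      simp at e1 e3
      omega
  · rintro ⟨_, hcN, hle⟩
    classical
    refine ⟨Finset.univ.filter (fun e => ∃ k : ℕ, k / c = e.1.1 ∧ k % N = e.2.1), ?_, ?_⟩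
    · intro u
      symm
      have := Finset.card_bij (s := Finset.range c)
        (t := (Finset.univ.filter (fun e : Fin M × Fin N =>
          ∃ k : ℕ, k / c = e.1.1 ∧ k % N = e.2.1)).filter (fun e => e.1 = u))
        (fun i _ => (u, ⟨(c * u.1 + i) % N, Nat.mod_lt _ hN⟩))
        (by
          intro i hi
          simp at hi
          simp
          refine ⟨c * u.1 + i, ?_, rfl⟩
          rw [Nat.mul_add_div hc, Nat.div_eq_of_lt hi, add_zero])
        (by
          intro i hi j hj h
          simp at hi hj h
          have h' : i ≡ j [MOD N] := Nat.ModEq.add_left_cancel' _ h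
          exact h'.eq_of_lt_of_lt (by omega) (by omega))
        (by
          rintro ⟨a, b⟩ h
          simp at h
          obtain ⟨⟨k, hk1, hk2⟩, rfl⟩ := h
          refine ⟨k % c, by simpa using Nat.mod_lt _ hc, ?_⟩
          ext
          · rfl
          · simp only [← hk1, Nat.div_add_mod, hk2])
      simpa using this
    · intro v
      have hb : ∀ j : Fin d, (v.1 + N * j.1) / c < M := by
        intro j
        rw [Nat.div_lt_iff_lt_mul hc]
        have : N * (j.1 + 1) ≤ N * d := Nat.mul_le_mul_left _ j.2
        have := v.2
        rw [mul_add] at *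
        omega
      have := Finset.card_le_card_of_injOn (s := (Finset.univ : Finset (Fin d)))
        (t := (Finset.univ.filter (fun e : Fin M × Fin N =>
          ∃ k : ℕ, k / c = e.1.1 ∧ k % N = e.2.1)).filter (fun e => e.2 = v))
        (fun j => (⟨(v.1 + N * j.1) / c, hb j⟩, v))
        (by
          intro j _
          simp
          exact ⟨v.1 + N * j.1, rfl, by simp [Nat.mod_eq_of_lt v.2]⟩)
        (by
          intro i _ j _ h
          simp at h
          have key : ∀ a b : ℕ, a < b → (v.1 + N * a) / c = (v.1 + N * b) / c → False := by
            intro a b hab h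
            have h1 : v.1 + N * a + c ≤ v.1 + N * b := by nlinarith
            have h2 := Nat.div_le_div_right (c := c) h1
            rw [Nat.add_div_right _ hc] at h2
            omega
          rcases lt_trichotomy i.1 j.1 with hl | he | hl
          · exact (key _ _ hl h).elim
          · exact Fin.ext he
          · exact (key _ _ hl h.symm).elim)
      simpa using this
end

section
/- Let c̄ ∈ ℕ^m and d̄ ∈ ℕ^n be vectors all of whose entries are at least 1. For every M̄ ∈ ℕ^m and N̄ ∈ ℕ^n with M̄·1̄ + N̄·1̄ ≥ 2(c̄·1̄)(d̄·1̄) + 3, the following holds: there exists a (c̄,d̄)-biregular graph of size (M̄,N̄) if and only if M̄·c̄ = N̄·d̄. -/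
/-- The vertex set of a part-structured side of a bipartite graph:
part `j` contains exactly `M j` vertices. -/
abbrev PartVert (m : ℕ) (M : Fin m → ℕ) : Type := (j : Fin m) × Fin (M j)

/-- Consecutive blocks: block `u` has size `c u`. -/
lemma exists_blocks {U : Type} [Fintype U] [DecidableEq U] (c : U → ℕ) (C e : ℕ)
    (hC : ∀ u, c u ≤ C) (he : ∑ u, c u = e) :
    ∃ f : Fin e → U, (∀ u, (Finset.univ.filter (fun k => f k = u)).card = c u) ∧
      ∀ x y, f x = f y → (x : ℕ) < y + C := by
  classical
  let ψ := (Fintype.equivFin U)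
  let c' : Fin (Fintype.card U) → ℕ := fun i => c (ψ.symm i)
  have he' : ∑ i, c' i = e := by
    rw [← he]; exact Equiv.sum_comp ψ.symm c
  subst he'
  let φ : ((i : Fin (Fintype.card U)) × Fin (c' i)) ≃ Fin (∑ i, c' i) := finSigmaFinEquiv
  refine ⟨fun k => ψ.symm (φ.symm k).1, ?_, ?_⟩
  · intro u
    have h1 : (Finset.univ.filter (fun k => ψ.symm (φ.symm k).1 = u)).card
        = ((Finset.univ : Finset (Fin (c' (ψ u)))).image (fun j => φ ⟨ψ u, j⟩)).card := by
      congr 1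
      ext k
      simp only [Finset.mem_filter, Finset.mem_univ, true_and, Finset.mem_image]
      constructor
      · intro h
        obtain ⟨⟨i, j⟩, rfl⟩ := φ.surjective k
        simp only [Equiv.symm_apply_apply] at h
        subst h
        have hi : ψ (ψ.symm i) = i := by simp
        refine ⟨Fin.cast (by rw [hi]) j, ?_⟩
        congr 1
        refine Sigma.ext hi ?_
        simp only
        rw [Fin.heq_ext_iff (by rw [hi])]
        simp
      · rintro ⟨j, rfl⟩
        simp
    rw [h1, Finset.card_image_of_injective]
    · simp [c']
    · intro a b hab
      have := φ.injective hab
      simpa using this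
  · intro x y h
    obtain ⟨⟨i, a⟩, rfl⟩ := φ.surjective x
    obtain ⟨⟨i', b⟩, rfl⟩ := φ.surjective y
    simp only [Equiv.symm_apply_apply, ψ.symm.injective.eq_iff] at h
    subst h
    have ha := a.2
    have hb : c' i ≤ C := hC _
    simp only [φ, finSigmaFinEquiv_apply]
    omega

/-- Position of `x` when residues mod `C` are listed in descending order. -/
def spreadPos (C e x : ℕ) : ℕ :=
  (e / C) * (C - 1 - x % C) + (e % C - 1 - x % C) + x / C

lemma spreadPos_lt_aux (C q r s t : ℕ) (hs : s < C) (hr : r < C)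
    (h : C * t + s < C * q + r) :
    t + 1 ≤ q ∨ (t = q ∧ s < r) := by
  by_cases h1 : t + 1 ≤ q
  · exact Or.inl h1
  · right
    have : q ≤ t := by omega
    obtain ⟨k, rfl⟩ := Nat.exists_eq_add_of_le this
    rcases Nat.eq_zero_or_pos k with rfl | hk
    · exact ⟨rfl, by simp at h; omega⟩
    · exfalso
      have : C * 1 ≤ C * k := Nat.mul_le_mul_left _ hk
      rw [Nat.mul_add] at h
      omega

lemma spreadPos_lt (C e x : ℕ) (hC : 0 < C) (hx : x < e) : spreadPos C e x < e := by
  unfold spreadPos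
  have h1 := Nat.div_add_mod e C
  have h2 := Nat.div_add_mod x C
  have hr := Nat.mod_lt e hC
  have hs := Nat.mod_lt x hC
  generalize e / C = q at *
  generalize e % C = r at *
  generalize x / C = t at *
  generalize x % C = s at *
  have := spreadPos_lt_aux C q r s t hs hr (by omega)
  obtain ⟨k, rfl⟩ := Nat.exists_eq_add_of_lt hs
  have e1 : s + k + 1 - 1 - s = k := by omega
  rw [e1]
  have e2 : (s + k + 1) * q = s * q + q * k + q := by ring
  rw [e2] at h1
  rcases Nat.eq_zero_or_pos (s * q) with h0 | h0 <;> omega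

lemma spreadPos_mono (C e x y : ℕ) (hC : 0 < C) (h : x % C < y % C) :
    spreadPos C e y + e / C + x / C + (e % C - 1 - x % C) ≤
      spreadPos C e x + y / C + (e % C - 1 - y % C) := by
  unfold spreadPos
  have hs' := Nat.mod_lt y hC
  generalize e / C = q at *
  generalize e % C = r at *
  generalize x / C = t at *
  generalize x % C = s at *
  generalize y / C = t' at *
  generalize y % C = s' at *
  have e1 : C - 1 - s = (C - 1 - s') + 1 + (s' - s - 1) := by omega
  rw [e1]
  have : q * ((C - 1 - s') + 1 + (s' - s - 1)) =
    q * (C - 1 - s') + q + q * (s' - s - 1) := by ring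
  rw [this]
  generalize q * (C - 1 - s') = A
  generalize q * (s' - s - 1) = B
  omega

lemma spreadPos_inj_aux (C e x y : ℕ) (hC : 0 < C) (hy : y < e)
    (h : x % C < y % C) : spreadPos C e y < spreadPos C e x := by
  have h0 := spreadPos_mono C e x y hC h
  have h1 := Nat.div_add_mod e C
  have h2 := Nat.div_add_mod y C
  have := spreadPos_lt_aux C (e / C) (e % C) (y % C) (y / C) (Nat.mod_lt _ hC)
    (Nat.mod_lt _ hC) (by omega)
  clear h1 h2 hy
  generalize e / C = q at *
  generalize e % C = r at *
  generalize x / C = t at *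
  generalize x % C = s at *
  generalize y / C = t' at *
  generalize y % C = s' at *
  omega

lemma spreadPos_inj (C e x y : ℕ) (hC : 0 < C) (hx : x < e) (hy : y < e)
    (h : spreadPos C e x = spreadPos C e y) : x = y := by
  rcases lt_trichotomy (x % C) (y % C) with h1 | h1 | h1
  · have := spreadPos_inj_aux C e x y hC hy h1
    omega
  · unfold spreadPos at h
    rw [h1] at h
    have h2 : x / C = y / C := by omega
    rw [← Nat.div_add_mod x C, ← Nat.div_add_mod y C, h1, h2]
  · have := spreadPos_inj_aux C e y x hC hx h1
    omega

lemma spreadPos_gap (C e x y : ℕ) (hC : 0 < C) (hxy : x < y) (hyx : y < x + C) :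
    spreadPos C e y + e / C ≤ spreadPos C e x ∨ spreadPos C e x + e / C ≤ spreadPos C e y := by
  have h1 := Nat.div_add_mod x C
  have h2 := Nat.div_add_mod y C
  have hs := Nat.mod_lt x hC
  have hs' := Nat.mod_lt y hC
  have hle : x / C ≤ y / C := Nat.div_le_div_right hxy.le
  have hle2 : y / C ≤ x / C + 1 := by
    have : y / C ≤ (x + C) / C := Nat.div_le_div_right hyx.le
    rwa [Nat.add_div_right _ hC] at this
  rcases Nat.eq_or_lt_of_le hle with heq | hlt
  · rw [← heq] at h2
    have h3 : x % C < y % C := by omega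
    have := spreadPos_mono C e x y hC h3
    omega
  · have heq : y / C = x / C + 1 := by omega
    rw [heq, Nat.mul_add] at h2
    have h3 : y % C < x % C := by omega
    have := spreadPos_mono C e y x hC h3
    omega

/-- A bipartite degree sequence is realizable as soon as the number of edges is
at least the product of bounds on the degrees. -/
lemma exists_graph {U V : Type} [Fintype U] [Fintype V] [DecidableEq U] [DecidableEq V]
    (c : U → ℕ) (d : V → ℕ) (C D e : ℕ) (hC0 : 0 < C)
    (hC : ∀ u, c u ≤ C) (hD : ∀ v, d v ≤ D) (hc : ∑ u, c u = e) (hd : ∑ v, d v = e)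
    (hCD : C * D ≤ e) :
    ∃ E : Finset (U × V), (∀ u, (E.filter (fun p => p.1 = u)).card = c u) ∧
      (∀ v, (E.filter (fun p => p.2 = v)).card = d v) := by
  obtain ⟨f, hf, hf'⟩ := exists_blocks c C e hC hc
  obtain ⟨g, hg, hg'⟩ := exists_blocks d D e hD hd
  have hq : D ≤ e / C := by
    rw [Nat.le_div_iff_mul_le hC0, Nat.mul_comm]; exact hCD
  let σ : Fin e → Fin e := fun k => ⟨spreadPos C e k, spreadPos_lt C e k hC0 k.2⟩
  have hσ : Function.Injective σ := by
    intro x y h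
    exact Fin.ext (spreadPos_inj C e x y hC0 x.2 y.2 (by simpa [σ] using h))
  have key : ∀ x y : Fin e, (x : ℕ) < y → f x = f y → g (σ x) = g (σ y) → False := by
    intro x y hxy h1 h2
    have a1 := hf' y x h1.symm
    have a2 : spreadPos C e x < spreadPos C e y + D := hg' _ _ h2
    have a3 : spreadPos C e y < spreadPos C e x + D := hg' _ _ h2.symm
    have := spreadPos_gap C e x y hC0 hxy a1
    omega
  have hinj : Function.Injective (fun k => (f k, g (σ k))) := by
    intro x y h
    simp only [Prod.mk.injEq] at h
    rcases lt_trichotomy (x : ℕ) y with h1 | h1 | h1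
    · exact (key x y h1 h.1 h.2).elim
    · exact Fin.ext h1
    · exact (key y x h1 h.1.symm h.2.symm).elim
  refine ⟨Finset.univ.image (fun k => (f k, g (σ k))), ?_, ?_⟩
  · intro u
    rw [Finset.filter_image, Finset.card_image_of_injective _ hinj]
    exact hf u
  · intro v
    rw [Finset.filter_image, Finset.card_image_of_injective _ hinj, ← hg v]
    refine Finset.card_equiv (Equiv.ofBijective σ hσ.bijective_of_finite) ?_
    intro i
    simp

/-- Let `c̄ ∈ ℕ^m` and `d̄ ∈ ℕ^n` have all entries at least 1. For
every `M̄ ∈ ℕ^m` and `N̄ ∈ ℕ^n` with `M̄·1̄ + N̄·1̄ ≥ 2(c̄·1̄)(d̄·1̄) + 3`: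
there exists a `(c̄,d̄)`-biregular graph of size `(M̄,N̄)` iff `M̄·c̄ = N̄·d̄`. -/
theorem biregular_exists_iff_of_big (m n : ℕ) (c : Fin m → ℕ) (d : Fin n → ℕ)
    (hc : ∀ i, 1 ≤ c i) (hd : ∀ j, 1 ≤ d j)
    (M : Fin m → ℕ) (N : Fin n → ℕ)
    (hbig : 2 * (∑ i, c i) * (∑ j, d j) + 3 ≤ (∑ i, M i) + (∑ j, N j)) :
    (∃ E : Finset (PartVert m M × PartVert n N),
      (∀ u : PartVert m M, (E.filter (fun e => e.1 = u)).card = c u.1) ∧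
      (∀ v : PartVert n N, (E.filter (fun e => e.2 = v)).card = d v.1)) ↔
    ∑ i, M i * c i = ∑ j, N j * d j := by
  have sU : ∑ u : PartVert m M, c u.1 = ∑ i, M i * c i := by
    rw [Fintype.sum_sigma]; simp
  have sV : ∑ v : PartVert n N, d v.1 = ∑ j, N j * d j := by
    rw [Fintype.sum_sigma]; simp
  constructor
  · rintro ⟨E, h1, h2⟩
    rw [← sU, ← sV]
    have a1 := Finset.card_eq_sum_card_fiberwise (s := E) (t := Finset.univ)
      (f := fun e => e.1) (by intro x _; simp)
    have a2 := Finset.card_eq_sum_card_fiberwise (s := E) (t := Finset.univ)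
      (f := fun e => e.2) (by intro x _; simp)
    simp only [h1] at a1
    simp only [h2] at a2
    rw [← a1, ← a2]
  · intro h
    have b1 : ∑ i, M i ≤ ∑ i, M i * c i :=
      Finset.sum_le_sum fun i _ => Nat.le_mul_of_pos_right _ (hc i)
    have b2 : ∑ j, N j ≤ ∑ j, N j * d j :=
      Finset.sum_le_sum fun i _ => Nat.le_mul_of_pos_right _ (hd i)
    have hCle : ∀ i, c i ≤ ∑ i, c i := fun i =>
      Finset.single_le_sum (fun _ _ => Nat.zero_le _) (Finset.mem_univ i)
    have hDle : ∀ j, d j ≤ ∑ j, d j := fun i =>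
      Finset.single_le_sum (fun _ _ => Nat.zero_le _) (Finset.mem_univ i)
    rw [Nat.mul_assoc] at hbig
    have hC0 : 0 < ∑ i, c i := by
      have : ∑ i, M i * c i ≠ 0 := by omega
      obtain ⟨i, -, -⟩ := Finset.exists_ne_zero_of_sum_ne_zero this
      exact lt_of_lt_of_le (hc i) (hCle i)
    exact exists_graph (fun u : PartVert m M => c u.1) (fun v : PartVert n N => d v.1)
      (∑ i, c i) (∑ j, d j) _ hC0 (fun u => hCle _) (fun v => hDle _) sU (sV.trans h.symm)
      (by omega)
end

section
/- Let C be an ℓ × m constraint matrix and D an ℓ × n constraint matrix, and write S_C = Σ_{i,j} ⌊C⌋_{i,j} and S_D = Σ_{i,j} ⌊D⌋_{i,j}. Let G = (U,V,E_1,…,E_ℓ) be an ℓ-type (C,D)-biregular graph with witnessing partitions U = U_1 ∪ … ∪ U_m and V = V_1 ∪ … ∪ V_n, and suppose |U_i| ≥ S_C + S_D + 1 for every 1 ≤ i ≤ m and |V_j| ≥ S_C + S_D + 1 for every 1 ≤ j ≤ n. If G is complete (E_1 ∪ … ∪ E_ℓ = U × V), then for every i ∈ {1,…,m} and j ∈ {1,…,n}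 there exists l ∈ {1,…,ℓ} such that both C_{l,i} and D_{l,j} are 'at least' constraints. -/
/-- A degree constraint: a pair `(d, b)` of a natural number and a Boolean flag.
`b = false` means 'exactly d', `b = true` means 'at least d'. -/
abbrev Constr : Type := ℕ × Bool

/-- `k` satisfies the degree constraint `c`. -/
def Constr.sat (c : Constr) (k : ℕ) : Prop :=
  if c.2 then c.1 ≤ k else k = c.1

/-- The degree of a left vertex `u` with respect to an edge set `E`. -/
def degL {α β : Type} [DecidableEq α] (E : Finset (α × β)) (u : α) : ℕ :=
  (E.filter fun e => e.1 = u).card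

/-- The degree of a right vertex `v` with respect to an edge set `E`. -/
def degR {α β : Type} [DecidableEq β] (E : Finset (α × β)) (v : β) : ℕ :=
  (E.filter fun e => e.2 = v).card

/-- There exists an `ℓ`-type `(C,D)`-biregular bipartite graph of size `(M̄,N̄)`:
pairwise disjoint edge sets `E_1,…,E_ℓ ⊆ U × V`, with `U` partitioned into parts
of sizes `M_1,…,M_m` and `V` into parts of sizes `N_1,…,N_n`, such that for each
`i`, every `u` in part `j` of `U` has `deg_{E_i}(u)` satisfying `C i j` and
every `v` in part `j` of `V` has `deg_{E_i}(v)` satisfying `D i j`. -/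
def ExistsBiregular (ℓ m n : ℕ) (C : Fin ℓ → Fin m → Constr) (D : Fin ℓ → Fin n → Constr)
    (M : Fin m → ℕ) (N : Fin n → ℕ) : Prop :=
  ∃ E : Fin ℓ → Finset (PartVert m M × PartVert n N),
    (∀ i i', i ≠ i' → Disjoint (E i) (E i')) ∧
    (∀ i (u : PartVert m M), Constr.sat (C i u.1) (degL (E i) u)) ∧
    (∀ i (v : PartVert n N), Constr.sat (D i v.1) (degR (E i) v))

/-- Let `C : ℓ × m` and `D : ℓ × n` be constraint matrices with
total numeric parts `S_C` and `S_D`, and let `(U, V, E_1,…,E_ℓ)` be an `ℓ`-type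
`(C,D)`-biregular graph with witnessing partitions (given by `pU : U → Fin m`
and `pV : V → Fin n`) all of whose parts have size at least `S_C + S_D + 1`.
If the graph is complete (`E_1 ∪ … ∪ E_ℓ = U × V`), then for every `i, j`
there exists `l` such that both `C l i` and `D l j` are 'at least'
constraints. -/
theorem complete_biregular_easy_pair (ℓ m n : ℕ)
    (C : Fin ℓ → Fin m → Constr) (D : Fin ℓ → Fin n → Constr)
    (U V : Type) [Fintype U] [DecidableEq U] [Fintype V] [DecidableEq V]
    (E : Fin ℓ → Finset (U × V))
    (hdisj : ∀ i i', i ≠ i' → Disjoint (E i) (E i'))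
    (pU : U → Fin m) (pV : V → Fin n)
    (hC : ∀ i (u : U), Constr.sat (C i (pU u)) (degL (E i) u))
    (hD : ∀ i (v : V), Constr.sat (D i (pV v)) (degR (E i) v))
    (hU : ∀ j : Fin m,
      (∑ i, ∑ j', (C i j').1) + (∑ i, ∑ j', (D i j').1) + 1 ≤
        (Finset.univ.filter (fun u : U => pU u = j)).card)
    (hV : ∀ j : Fin n,
      (∑ i, ∑ j', (C i j').1) + (∑ i, ∑ j', (D i j').1) + 1 ≤
        (Finset.univ.filter (fun v : V => pV v = j)).card)
    (hcomp : ∀ (u : U) (v : V), ∃ i, (u, v) ∈ E i) :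
    ∀ (i : Fin m) (j : Fin n), ∃ l : Fin ℓ, (C l i).2 = true ∧ (D l j).2 = true := by
  intro i j
  by_contra hcon
  push Not at hcon
  set A := Finset.univ.filter (fun u : U => pU u = i) with hA
  set B := Finset.univ.filter (fun v : V => pV v = j) with hB
  have ha := hU i
  have hb := hV j
  rw [← hA] at ha
  rw [← hB] at hb
  have key : ∀ l, ((E l).filter (fun e => e ∈ A ×ˢ B)).card ≤
      (C l i).1 * A.card + (D l j).1 * B.card := by
    intro l
    by_cases h : (C l i).2 = true
    · have h2 := hcon l h
      refine le_trans ?_ (Nat.le_add_left _ _)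
      refine Finset.card_le_mul_card_image_of_maps_to (f := Prod.snd) ?_ _ ?_
      · intro e he
        exact (Finset.mem_product.1 (Finset.mem_filter.1 he).2).2
      · intro v hv
        have hv' : pV v = j := (Finset.mem_filter.1 hv).2
        have := hD l v
        rw [hv'] at this
        simp only [Constr.sat, h2, if_false] at this
        rw [← this, degR]
        exact Finset.card_le_card (Finset.filter_subset_filter _ (Finset.filter_subset _ _))
    · refine le_trans ?_ (Nat.le_add_right _ _)
      refine Finset.card_le_mul_card_image_of_maps_to (f := Prod.fst) ?_ _ ?_
      · intro e he
        exact (Finset.mem_product.1 (Finset.mem_filter.1 he).2).1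
      · intro u hu
        have hu' : pU u = i := (Finset.mem_filter.1 hu).2
        have := hC l u
        rw [hu'] at this
        simp only [Constr.sat, h, if_false] at this
        rw [← this, degL]
        exact Finset.card_le_card (Finset.filter_subset_filter _ (Finset.filter_subset _ _))
  have hle : A.card * B.card ≤ (∑ l, (C l i).1) * A.card + (∑ l, (D l j).1) * B.card := by
    rw [← Finset.card_product, Finset.sum_mul, Finset.sum_mul, ← Finset.sum_add_distrib]
    refine le_trans ?_ (Finset.sum_le_sum fun l _ => key l)
    refine le_trans (Finset.card_le_card ?_) Finset.card_biUnion_le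
    intro e he
    obtain ⟨l, hl⟩ := hcomp e.1 e.2
    exact Finset.mem_biUnion.2 ⟨l, Finset.mem_univ _, Finset.mem_filter.2 ⟨hl, he⟩⟩
  have hc : ∑ l, (C l i).1 ≤ ∑ l, ∑ j', (C l j').1 := Finset.sum_le_sum fun l _ =>
    Finset.single_le_sum (f := fun j' => (C l j').1) (fun _ _ => Nat.zero_le _) (Finset.mem_univ i)
  have hd : ∑ l, (D l j).1 ≤ ∑ l, ∑ j', (D l j').1 := Finset.sum_le_sum fun l _ =>
    Finset.single_le_sum (f := fun j' => (D l j').1) (fun _ _ => Nat.zero_le _) (Finset.mem_univ j)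
  generalize (∑ l, (C l i).1) = c at *
  generalize (∑ l, (D l j).1) = d at *
  have ha' : c + d + 1 ≤ A.card := by omega
  have hb' : c + d + 1 ≤ B.card := by omega
  generalize A.card = a at *
  generalize B.card = b at *
  rcases le_total a b with h | h
  · nlinarith [Nat.mul_le_mul_left c h, Nat.mul_le_mul_right b ha']
  · nlinarith [Nat.mul_le_mul_left d h, Nat.mul_le_mul_left a hb']
end

section
/- Let C be an ℓ × m constraint matrix and D an ℓ × n constraint matrix forming an easy pair, i.e. for every i ∈ {1,…,m} and j ∈ {1,…,n} there exists l ∈ {1,…,ℓ} such that both C_{l,i} and D_{l,j} are 'at least' constraints. Then for every (M̄,N̄) ∈ ℕ^m × ℕ^n: there exists an ℓ-type (C,D)-biregular graph of size (M̄,N̄) that is complete (E_1 ∪ … ∪ E_ℓ = U × V) if and only if there exists an ℓ-type (C,D)-biregular graph of size (M̄,N̄). -/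
/-- There exists an `ℓ`-type `(C,D)`-biregular bipartite graph of size `(M̄,N̄)`
that is moreover complete: `E_1 ∪ … ∪ E_ℓ = U × V`. -/
def ExistsCompBiregular (ℓ m n : ℕ) (C : Fin ℓ → Fin m → Constr) (D : Fin ℓ → Fin n → Constr)
    (M : Fin m → ℕ) (N : Fin n → ℕ) : Prop :=
  ∃ E : Fin ℓ → Finset (PartVert m M × PartVert n N),
    (∀ i i', i ≠ i' → Disjoint (E i) (E i')) ∧
    (∀ i (u : PartVert m M), Constr.sat (C i u.1) (degL (E i) u)) ∧
    (∀ i (v : PartVert n N), Constr.sat (D i v.1) (degR (E i) v)) ∧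
    (∀ (u : PartVert m M) (v : PartVert n N), ∃ i, (u, v) ∈ E i)

theorem Constr.sat_of_le {c : Constr} {a b : ℕ} (h : c.sat a) (hab : a ≤ b)
    (he : c.2 = false → b = a) : c.sat b := by
  unfold Constr.sat at *
  cases hc : c.2 <;> simp [hc] at * <;> omega

/-- If `C : ℓ × m` and `D : ℓ × n` form an easy pair of constraint
matrices (for every column `i` of `C` and column `j` of `D` there is a row `l`
in which both entries are 'at least' constraints), then for every `(M̄,N̄)`:
a complete `ℓ`-type `(C,D)`-biregular graph of size `(M̄,N̄)` exists iff an
`ℓ`-type `(C,D)`-biregular graph of size `(M̄,N̄)` exists. -/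
theorem easy_pair_complete_iff (ℓ m n : ℕ)
    (C : Fin ℓ → Fin m → Constr) (D : Fin ℓ → Fin n → Constr)
    (heasy : ∀ (i : Fin m) (j : Fin n),
      ∃ l : Fin ℓ, (C l i).2 = true ∧ (D l j).2 = true)
    (M : Fin m → ℕ) (N : Fin n → ℕ) :
    ExistsCompBiregular ℓ m n C D M N ↔ ExistsBiregular ℓ m n C D M N := by
  constructor
  · rintro ⟨E, h1, h2, h3, -⟩
    exact ⟨E, h1, h2, h3⟩
  rintro ⟨E, h1, h2, h3⟩
  classical
  choose f hfC hfD using heasy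
  let A : Fin ℓ → Finset (PartVert m M × PartVert n N) := fun l =>
    Finset.univ.filter fun e => (∀ i, e ∉ E i) ∧ f e.1.1 e.2.1 = l
  have hA : ∀ l e, e ∈ A l ↔ (∀ i, e ∉ E i) ∧ f e.1.1 e.2.1 = l := by
    intro l e
    simp only [A, Finset.mem_filter, Finset.mem_univ, true_and]
  refine ⟨fun l => E l ∪ A l, ?_, ?_, ?_, ?_⟩
  · intro i i' hne
    rw [Finset.disjoint_left]
    intro e he he'
    rw [Finset.mem_union, hA] at he he'
    rcases he with he | ⟨he, hf⟩
    · rcases he' with he' | ⟨he', -⟩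
      · exact Finset.disjoint_left.mp (h1 i i' hne) he he'
      · exact he' i he
    · rcases he' with he' | ⟨-, hf'⟩
      · exact he i' he'
      · exact hne (hf.symm.trans hf')
  · intro i u
    refine Constr.sat_of_le (h2 i u) ?_ ?_
    · exact Finset.card_le_card (Finset.filter_subset_filter _ Finset.subset_union_left)
    · intro hc
      unfold degL
      congr 1
      ext e
      simp only [Finset.mem_filter, Finset.mem_union, hA]
      constructor
      · rintro ⟨he | ⟨-, hf⟩, rfl⟩
        · exact ⟨he, rfl⟩
        · have := hfC e.1.1 e.2.1
          rw [hf, hc] at this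
          cases this
      · rintro ⟨he, h⟩
        exact ⟨Or.inl he, h⟩
  · intro i v
    refine Constr.sat_of_le (h3 i v) ?_ ?_
    · exact Finset.card_le_card (Finset.filter_subset_filter _ Finset.subset_union_left)
    · intro hc
      unfold degR
      congr 1
      ext e
      simp only [Finset.mem_filter, Finset.mem_union, hA]
      constructor
      · rintro ⟨he | ⟨-, hf⟩, rfl⟩
        · exact ⟨he, rfl⟩
        · have := hfD e.1.1 e.2.1
          rw [hf, hc] at this
          cases this
      · rintro ⟨he, h⟩
        exact ⟨Or.inl he, h⟩
  · intro u v
    by_cases h : ∃ i, (u, v) ∈ E i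
    · obtain ⟨i, hi⟩ := h
      exact ⟨i, Finset.mem_union_left _ hi⟩
    · push Not at h
      exact ⟨f u.1 v.1, Finset.mem_union_right _ ((hA _ _).2 ⟨h, rfl⟩)⟩
end
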